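/- Every feasible solution of the cyclically modified program ĒI(T) is a feasible solution of EI(T). That is, if x ≥ 0 satisfies Σ_{k∈K_j} x_{jk}^t ≤ 1 for all j, t and the cyclic capacity constraints of ĒI(T), then x also satisfies all the capacity constraints of EI(T). -/

import Mathlib

open Finset

variable {V : Type} [Fintype V] [DecidableEq V]

/-- `L̄`: the links of the network together with all self-loops. -/
def Lbar (L : Finset (V × V)) : Finset (V × V) :=
  L ∪ Finset.univ.image (fun v => (v, v))

/-- A route-schedule for a packet type with source `s`, destination `z` and deadline `d`:
a directed walk `k = (k_0, …, k_d)` of edges of `L̄` with `k_0` going out of `s`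
and `k_d` going into `z`. -/
def IsRouteSchedule (L : Finset (V × V)) (s z : V) (d : ℕ)
    (k : Fin (d + 1) → V × V) : Prop :=
  (∀ τ, k τ ∈ Lbar L) ∧
  (∀ τ : Fin (d + 1), ∀ h : (τ : ℕ) + 1 < d + 1, (k τ).2 = (k ⟨(τ : ℕ) + 1, h⟩).1) ∧
  (k 0).1 = s ∧ (k (Fin.last d)).2 = z

open Classical in
/-- The (finite) set `K` of all route-schedules for source `s`, destination `z`,
deadline `d`. -/
noncomputable def RS (L : Finset (V × V)) (s z : V) (d : ℕ) :
    Finset (Fin (d + 1) → V × V) :=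
  Finset.univ.filter (IsRouteSchedule L s z d)

open Classical in
/-- `∑_{k ∈ K : k_τ = ℓ} x_k`, with the convention that the indicator `[k_τ = ℓ]` is `0`
when `τ ∉ {0, …, d}`. -/
noncomputable def schedAt (L : Finset (V × V)) (s z : V) (d : ℕ)
    (x : (Fin (d + 1) → V × V) → ℝ) (τ : ℕ) (ℓ : V × V) : ℝ :=
  ∑ k ∈ RS L s z d, if h : τ < d + 1 then (if k ⟨τ, h⟩ = ℓ then x k else 0) else 0

/-- Maximum deadline `d_max` over all packet types. -/
def dmax {J : ℕ} (d : Fin J → ℕ) : ℕ := Finset.univ.sup d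

/-- Objective of the expected-instance LP `EI(T)`:
`∑_{t=1}^T ∑_j w_j λ_j^t ∑_{k ∈ K_j} x_{jk}^t`. -/
noncomputable def EIObj (L : Finset (V × V)) {J : ℕ} (src dst : Fin J → V)
    (d : Fin J → ℕ) (w : Fin J → ℝ) (T : ℕ) (lam : Fin J → ℕ → ℝ)
    (x : (j : Fin J) → (Fin (d j + 1) → V × V) → ℕ → ℝ) : ℝ :=
  ∑ t ∈ Finset.Icc 1 T, ∑ j,
    w j * lam j t * ∑ k ∈ RS L (src j) (dst j) (d j), x j k t

/-- Feasibility for `EI(T)`: `x ≥ 0`; `∑_{k ∈ K_j} x_{jk}^t ≤ 1` for all `j ∈ [J]`,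
`t ∈ [T]`; and for every `ℓ ∈ L` and `t ∈ [T + d_max]`:
`∑_{τ = max(t - d_max, 1)}^{min(t,T)} ∑_j λ_j^τ ∑_{k ∈ K_j : k_{t-τ} = ℓ} x_{jk}^τ ≤ C_ℓ`. -/
def EIFeasible (L : Finset (V × V)) (C : V × V → ℝ) {J : ℕ} (src dst : Fin J → V)
    (d : Fin J → ℕ) (T : ℕ) (lam : Fin J → ℕ → ℝ)
    (x : (j : Fin J) → (Fin (d j + 1) → V × V) → ℕ → ℝ) : Prop :=
  (∀ j k t, 0 ≤ x j k t) ∧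
  (∀ j, ∀ t ∈ Finset.Icc 1 T, ∑ k ∈ RS L (src j) (dst j) (d j), x j k t ≤ 1) ∧
  (∀ ℓ ∈ L, ∀ t ∈ Finset.Icc 1 (T + dmax d),
    ∑ τ ∈ Finset.Icc (max (t - dmax d) 1) (min t T), ∑ j,
      lam j τ * schedAt L (src j) (dst j) (d j) (fun k => x j k τ) (t - τ) ℓ ≤ C ℓ)

/-- `W_EI(T)`: the optimal value of the LP `EI(T)`. -/
noncomputable def EIOpt (L : Finset (V × V)) (C : V × V → ℝ) {J : ℕ}
    (src dst : Fin J → V) (d : Fin J → ℕ) (w : Fin J → ℝ) (T : ℕ)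
    (lam : Fin J → ℕ → ℝ) : ℝ :=
  sSup {r : ℝ | ∃ x, EIFeasible L C src dst d T lam x ∧ EIObj L src dst d w T lam x = r}

/-- The representative in `[T] = {1, …, T}` of an integer time index `τ` modulo `T`. -/
def cyclicRep (T : ℕ) (τ : ℤ) : ℕ := ((τ - 1) % (T : ℤ)).toNat + 1

/-- Feasibility for the cyclically modified program `ĒI(T)` (stationary rates `λ_j`):
`x ≥ 0`; `∑_{k ∈ K_j} x_{jk}^t ≤ 1` for all `j`, `t ∈ [T]`; and for every `ℓ ∈ L` and
`t ∈ [T]`: `∑_{τ = t - d_max}^{t} ∑_j λ_j ∑_{k ∈ K_j : k_{t-τ} = ℓ} x_{jk}^{τ'} ≤ C_ℓ`,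
where `τ' ∈ [T]` is the representative of `τ` modulo `T`. -/
def EIbarFeasible (L : Finset (V × V)) (C : V × V → ℝ) {J : ℕ} (src dst : Fin J → V)
    (d : Fin J → ℕ) (T : ℕ) (lam : Fin J → ℝ)
    (x : (j : Fin J) → (Fin (d j + 1) → V × V) → ℕ → ℝ) : Prop :=
  (∀ j k t, 0 ≤ x j k t) ∧
  (∀ j, ∀ t ∈ Finset.Icc 1 T, ∑ k ∈ RS L (src j) (dst j) (d j), x j k t ≤ 1) ∧
  (∀ ℓ ∈ L, ∀ t ∈ Finset.Icc 1 T,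
    ∑ τ ∈ Finset.Icc ((t : ℤ) - (dmax d : ℤ)) (t : ℤ), ∑ j,
      lam j * schedAt L (src j) (dst j) (d j) (fun k => x j k (cyclicRep T τ))
        ((t : ℤ) - τ).toNat ℓ ≤ C ℓ)

theorem cyclicRep_sub_of_dvd {T τ s : ℕ} (hτ : 1 ≤ τ) (hτT : τ ≤ T) (hs : T ∣ s) :
    cyclicRep T ((τ : ℤ) - s) = τ := by
  obtain ⟨q, rfl⟩ := hs
  have h : ((τ : ℤ) - (T * q : ℕ) - 1) % (T : ℤ) = (τ : ℤ) - 1 := by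
    rw [show (τ : ℤ) - (T * q : ℕ) - 1 = ((τ : ℤ) - 1) - T * q by push_cast; ring,
      Int.sub_mul_emod_self_left, Int.emod_eq_of_lt (by omega) (by omega)]
  rw [cyclicRep, h]
  omega

/-- A window of a nonnegative function truncated to `[T]` sums to at most the cyclic window
obtained by shifting it back by a multiple of `T`. -/
theorem sum_truncated_window_le_sum_cyclic_window (F : ℕ → ℕ → ℝ) (hF : ∀ τ m, 0 ≤ F τ m)
    {T D t u s : ℕ} (hs : T ∣ s) (ht : t = u + s) :
    ∑ τ ∈ Finset.Icc (max (t - D) 1) (min t T), F τ (t - τ) ≤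
      ∑ τ ∈ Finset.Icc ((u : ℤ) - (D : ℤ)) (u : ℤ), F (cyclicRep T τ) ((u : ℤ) - τ).toNat := by
  have hinj : Set.InjOn (fun τ : ℕ => (τ : ℤ) - s)
      (Finset.Icc (max (t - D) 1) (min t T) : Finset ℕ) := by
    intro a _ b _ hab
    simp only at hab
    omega
  calc ∑ τ ∈ Finset.Icc (max (t - D) 1) (min t T), F τ (t - τ)
      = ∑ τ ∈ Finset.Icc (max (t - D) 1) (min t T),
          F (cyclicRep T ((τ : ℤ) - s)) ((u : ℤ) - ((τ : ℤ) - s)).toNat := by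
        refine Finset.sum_congr rfl fun τ hτ => ?_
        rw [Finset.mem_Icc] at hτ
        rw [cyclicRep_sub_of_dvd (by omega) (by omega) hs]
        congr 1
        omega
    _ = ∑ τ ∈ (Finset.Icc (max (t - D) 1) (min t T)).image (fun τ : ℕ => (τ : ℤ) - s),
          F (cyclicRep T τ) ((u : ℤ) - τ).toNat := by rw [Finset.sum_image hinj]
    _ ≤ _ := by
        refine Finset.sum_le_sum_of_subset_of_nonneg ?_ fun _ _ _ => hF _ _
        intro σ hσ
        simp only [Finset.mem_image, Finset.mem_Icc] at hσ ⊢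
        omega

theorem schedAt_nonneg (L : Finset (V × V)) (s z : V) (d : ℕ)
    {x : (Fin (d + 1) → V × V) → ℝ} (hx : ∀ k, 0 ≤ x k) (τ : ℕ) (ℓ : V × V) :
    0 ≤ schedAt L s z d x τ ℓ := by
  refine Finset.sum_nonneg fun k _ => ?_
  split_ifs
  exacts [hx k, le_rfl, le_rfl]

/-- Every feasible solution of the cyclically modified program `ĒI(T)` is a feasible
solution of `EI(T)`. -/
theorem stmt2 {V : Type} [Fintype V] [DecidableEq V]
    (L : Finset (V × V)) (C : V × V → ℝ) (hC : ∀ ℓ ∈ L, 0 < C ℓ)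
    {J : ℕ} (hJ : 1 ≤ J) (src dst : Fin J → V) (d : Fin J → ℕ)
    (w : Fin J → ℝ) (hw : ∀ j, 0 ≤ w j)
    (T : ℕ) (hT : 2 * dmax d < T)
    (lam : Fin J → ℝ) (hlam : ∀ j, 0 ≤ lam j)
    (x : (j : Fin J) → (Fin (d j + 1) → V × V) → ℕ → ℝ)
    (hx : EIbarFeasible L C src dst d T lam x) :
    EIFeasible L C src dst d T (fun j _ => lam j) x := by
  obtain ⟨hx0, hx1, hcap⟩ := hx
  refine ⟨hx0, hx1, fun ℓ hℓ t ht => ?_⟩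
  rw [Finset.mem_Icc] at ht
  obtain ⟨u, s, hs, hts, hu⟩ : ∃ u s, T ∣ s ∧ t = u + s ∧ u ∈ Finset.Icc 1 T := by
    simp only [Finset.mem_Icc]
    rcases le_or_gt t T with h | h
    · exact ⟨t, 0, dvd_zero T, by omega, by omega⟩
    · exact ⟨t - T, T, dvd_rfl, by omega, by omega⟩
  refine (sum_truncated_window_le_sum_cyclic_window
    (fun τ m => ∑ j, lam j * schedAt L (src j) (dst j) (d j) (fun k => x j k τ) m ℓ)
    (fun τ m => Finset.sum_nonneg fun j _ =>
      mul_nonneg (hlam j) (schedAt_nonneg L _ _ _ (fun k => hx0 j k τ) m ℓ))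
    hs hts).trans (hcap ℓ hℓ u hu)
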